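/- arXiv:2103.07445 — 3 statements merged into one kernel-verified Lean document; each statement's English description precedes it below -/
import Mathlib

section
/- Let f = G·(T_1 + T_2), where G, T_1, T_2 ∈ F[x_1,…,x_n] are products of linear forms, T_1 and T_2 are homogeneous of equal degree at most d (with d ≥ 1), T_1 and T_2 have no common linear factor (gcd(T_1,T_2) = 1), and the linear factors of T_1·T_2 span an F-subspace of dimension at least 5. Then the number of codimension-2 subspaces of F^n on which NonLin(f) vanishes satisfies |S(NonLin(f))| ≤ 3d^7. -/
open MvPolynomial

/-- A linear form: a nonzero homogeneous degree-1 polynomial. -/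
def IsLinearForm {F : Type*} [Field F] {n : ℕ} (ℓ : MvPolynomial (Fin n) F) : Prop :=
  ℓ ≠ 0 ∧ ℓ.IsHomogeneous 1

/-- A product of linear forms (a nonzero scalar multiple of a product of linear forms). -/
def IsProdLinearForms {F : Type*} [Field F] {n : ℕ} (g : MvPolynomial (Fin n) F) : Prop :=
  ∃ (c : F) (L : Multiset (MvPolynomial (Fin n) F)),
    c ≠ 0 ∧ (∀ p ∈ L, IsLinearForm p) ∧ g = c • L.prod

/-- `g` has no linear factors. -/
def NoLinearFactor {F : Type*} [Field F] {n : ℕ} (g : MvPolynomial (Fin n) F) : Prop :=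
  ∀ ℓ : MvPolynomial (Fin n) F, IsLinearForm ℓ → ¬ ℓ ∣ g

/-- `h` is the non-linear part `NonLin(f)` of `f` (up to scalars): `h` has no linear
factors and `f` is a product of linear forms times `h`. -/
def IsNonLinPart {F : Type*} [Field F] {n : ℕ} (f h : MvPolynomial (Fin n) F) : Prop :=
  NoLinearFactor h ∧ ∃ L : MvPolynomial (Fin n) F, IsProdLinearForms L ∧ f = L * h

/-- `S(g)`: the set of codimension-2 subspaces `V(ℓ₁,ℓ₂)` of `F^n` on which `g`
vanishes, i.e. `g` belongs to the ideal generated by `ℓ₁, ℓ₂`. -/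
def vanishCodim2 {F : Type*} [Field F] {n : ℕ} (g : MvPolynomial (Fin n) F) :
    Set (Set (Fin n → F)) :=
  {W | ∃ ℓ₁ ℓ₂ : MvPolynomial (Fin n) F, IsLinearForm ℓ₁ ∧ IsLinearForm ℓ₂ ∧
    LinearIndependent F ![ℓ₁, ℓ₂] ∧
    W = {a : Fin n → F | eval a ℓ₁ = 0 ∧ eval a ℓ₂ = 0} ∧
    g ∈ Ideal.span {ℓ₁, ℓ₂}}

section LinearAlgebra

open Module Submodule

variable {K V : Type*} [Field K] [AddCommGroup V] [Module K V]

theorem Submodule.finrank_span_pair_le (a b : V) : finrank K (span K {a, b}) ≤ 2 := by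
  classical
  have h := finrank_span_finset_le_card (R := K) ({a, b} : Finset V)
  rw [Finset.coe_pair] at h
  exact h.trans Finset.card_le_two

instance Submodule.finiteDimensional_span_pair (a b : V) :
    FiniteDimensional K (span K {a, b}) :=
  FiniteDimensional.span_of_finite K (Set.toFinite _)

/-- In a plane, a proper subspace containing a nonzero vector is the line it spans. -/
theorem Submodule.eq_span_singleton_of_finrank_lt_two {U : Submodule K V} [FiniteDimensional K U]
    (hU : finrank K U < 2) {x : V} (hx : x ∈ U) (hx0 : x ≠ 0) : U = span K {x} := by
  refine (eq_of_le_of_finrank_le ((span_singleton_le_iff_mem _ _).2 hx) ?_).symm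
  rw [finrank_span_singleton hx0]
  omega

theorem Submodule.sup_span_singleton_eq_of_finrank_eq_two {U I : Submodule K V}
    (hI : finrank K I = 2) (hU : finrank K U = 1) (hUI : U ≤ I) {w : V} (hw : w ∈ I)
    (hwU : w ∉ U) : U ⊔ span K {w} = I := by
  have : FiniteDimensional K I := finite_of_finrank_pos (by omega)
  have hle : U ⊔ span K {w} ≤ I := sup_le hUI ((span_singleton_le_iff_mem _ _).2 hw)
  have : FiniteDimensional K ↥(U ⊔ span K {w}) := finiteDimensional_of_le hle
  refine eq_of_le_of_finrank_le hle ?_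
  have hlt : U < U ⊔ span K {w} :=
    lt_of_le_of_ne le_sup_left fun h ↦ hwU (h ▸ mem_sup_right (mem_span_singleton_self w))
  have := finrank_lt_finrank_of_lt hlt
  omega

/-- A plane `I` meeting the lines of a configuration (all taken projectively) that spans at least
five dimensions contains a point determined by at most three of the lines. -/
theorem exists_line_le_of_meets_planes {ι : Type*} (P : ι → Submodule K V)
    [∀ i, FiniteDimensional K (P i)] (hP : ∀ i, finrank K (P i) ≤ 2)
    {I : Submodule K V} (hI : finrank K I = 2) (R : Set ι)
    (hR : ∀ i ∈ R, ∃ w ∈ I, w ∈ P i ∧ w ≠ 0) {S : Submodule K V} (hS : 5 ≤ finrank K S)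
    (hSR : S ≤ ⨆ i ∈ R, P i) :
    ∃ i ∈ R, ∃ j ∈ R, ∃ k ∈ R,
      (finrank K ↥(P i ⊓ P j) = 1 ∧ P i ⊓ P j ≤ I) ∨
      (finrank K ↥((P i ⊔ P j) ⊓ P k) = 1 ∧ (P i ⊔ P j) ⊓ P k ≤ I) := by
  have key (T : Submodule K V) [FiniteDimensional K T] (hT : finrank K T < 5) :
      ∃ i ∈ R, ¬ P i ≤ T := by
    by_contra! hcon
    have := finrank_mono (hSR.trans (iSup₂_le hcon))
    omega
  have line {U : Submodule K V} {k : ι} (hU : U < P k) {x : V} (hx : x ∈ U) (hx0 : x ≠ 0)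
      (hxI : x ∈ I) : finrank K U = 1 ∧ U ≤ I := by
    have : FiniteDimensional K U := finiteDimensional_of_le hU.le
    have h := eq_span_singleton_of_finrank_lt_two
      ((finrank_lt_finrank_of_lt hU).trans_le (hP k)) hx hx0
    exact ⟨h ▸ finrank_span_singleton hx0, h ▸ (span_singleton_le_iff_mem _ _).2 hxI⟩
  obtain ⟨i, hi, -⟩ := key ⊥ (by simp)
  obtain ⟨j, hj, hji⟩ := key (P i) (by have := hP i; omega)
  obtain ⟨k, hk, hkij⟩ := key (P i ⊔ P j) (by
    have := finrank_add_le_finrank_add_finrank (P i) (P j)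
    have := hP i
    have := hP j
    omega)
  refine ⟨i, hi, j, hj, k, hk, ?_⟩
  by_cases hIij : I ≤ P i ⊔ P j
  · obtain ⟨w, hwI, hwk, hw0⟩ := hR k hk
    exact Or.inr (line (lt_of_le_of_ne inf_le_right fun h ↦ hkij (inf_eq_right.1 h))
      ⟨hIij hwI, hwk⟩ hw0 hwI)
  · obtain ⟨u, huI, hui, hu0⟩ := hR i hi
    obtain ⟨w, hwI, hwj, hw0⟩ := hR j hj
    have huj : u ∈ P j := by
      by_contra huj
      have hle : span K {w} ≤ P j := (span_singleton_le_iff_mem _ _).2 hwj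
      rw [← sup_span_singleton_eq_of_finrank_eq_two hI (finrank_span_singleton hw0)
        ((span_singleton_le_iff_mem _ _).2 hwI) huI fun h ↦ huj (hle h)] at hIij
      exact hIij (sup_le (hle.trans le_sup_right)
        (((span_singleton_le_iff_mem _ _).2 hui).trans le_sup_left))
    exact Or.inl (line (lt_of_le_of_ne inf_le_right fun h ↦ hji (inf_eq_right.1 h))
      ⟨hui, huj⟩ hu0 huI)

end LinearAlgebra

namespace MvPolynomial

open Module Submodule

variable {F : Type*} [Field F] {n : ℕ}

/-- For a space `W` of linear forms, a linear projection killing `W` extends to a linear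
substitution whose kernel is the ideal generated by `W`. -/
theorem exists_substitution_of_le_homogeneousSubmodule
    {W : Submodule F (MvPolynomial (Fin n) F)} (hW : W ≤ homogeneousSubmodule (Fin n) F 1) :
    ∃ φ : MvPolynomial (Fin n) F →ₐ[F] MvPolynomial (Fin n) F,
      (∀ m p, p.IsHomogeneous m → (φ p).IsHomogeneous m) ∧
      (∀ p, φ p = 0 ↔ p ∈ Ideal.span (W : Set (MvPolynomial (Fin n) F))) ∧
      (∀ p, p.IsHomogeneous 1 → p - φ p ∈ W) := by
  obtain ⟨C, hC⟩ := W.exists_isCompl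
  set π := C.projection W hC.symm
  have hπ (p : MvPolynomial (Fin n) F) : p - π p ∈ W := C.sub_projection_mem hC.symm p
  have hπX (i : Fin n) : (π (X i)).IsHomogeneous 1 := by
    simpa using (isHomogeneous_X F i).sub (hW (hπ (X i)))
  set φ : MvPolynomial (Fin n) F →ₐ[F] MvPolynomial (Fin n) F := aeval fun i ↦ π (X i)
  have hφπ (p : MvPolynomial (Fin n) F) (hp : p.IsHomogeneous 1) : φ p = π p := by
    have hp' : p ∈ span F (Set.range (X : Fin n → MvPolynomial (Fin n) F)) := by
      rwa [← homogeneousSubmodule_one_eq_span_X]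
    refine LinearMap.eqOn_span (f := φ.toLinearMap) (g := π) ?_ hp'
    rintro _ ⟨i, rfl⟩
    simp [φ]
  refine ⟨φ, fun m p hp ↦ one_mul m ▸ hp.aeval _ hπX, fun p ↦ ⟨fun hp ↦ ?_, fun hp ↦ ?_⟩,
    fun p hp ↦ hφπ p hp ▸ hπ p⟩
  · suffices h : ∀ q, q - φ q ∈ Ideal.span (W : Set (MvPolynomial (Fin n) F)) by
      simpa [hp] using h p
    intro q
    induction q using MvPolynomial.induction_on with
    | C a => simp [φ]
    | add p q hp hq =>
      rw [map_add, add_sub_add_comm]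
      exact add_mem hp hq
    | mul_X p i hp =>
      have hX : X i - φ (X i) ∈ Ideal.span (W : Set (MvPolynomial (Fin n) F)) :=
        Ideal.subset_span (hφπ _ (isHomogeneous_X F i) ▸ hπ (X i))
      have h := add_mem (Ideal.mul_mem_right (X i) _ hp) (Ideal.mul_mem_left _ (φ p) hX)
      rw [map_mul]
      convert h using 1
      ring
  · have hle : Ideal.span (W : Set (MvPolynomial (Fin n) F)) ≤ RingHom.ker φ := by
      refine Ideal.span_le.2 fun w hw ↦ ?_
      rw [SetLike.mem_coe, RingHom.mem_ker, hφπ w (hW hw)]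
      exact C.projection_apply_of_mem_right hC.symm hw
    exact hle hp

theorem isPrime_span_of_le_homogeneousSubmodule
    {W : Submodule F (MvPolynomial (Fin n) F)} (hW : W ≤ homogeneousSubmodule (Fin n) F 1) :
    (Ideal.span (W : Set (MvPolynomial (Fin n) F))).IsPrime := by
  obtain ⟨φ, -, hφ, -⟩ := exists_substitution_of_le_homogeneousSubmodule hW
  have : Ideal.span (W : Set (MvPolynomial (Fin n) F)) = RingHom.ker φ := by
    ext p
    rw [RingHom.mem_ker, hφ]
  rw [this]
  exact RingHom.ker_isPrime φ

theorem mem_ideal_span_iff_of_isHomogeneous_one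
    {W : Submodule F (MvPolynomial (Fin n) F)} (hW : W ≤ homogeneousSubmodule (Fin n) F 1)
    {p : MvPolynomial (Fin n) F} (hp : p.IsHomogeneous 1) :
    p ∈ Ideal.span (W : Set (MvPolynomial (Fin n) F)) ↔ p ∈ W := by
  obtain ⟨φ, -, hφ, h⟩ := exists_substitution_of_le_homogeneousSubmodule hW
  refine ⟨fun hpW ↦ ?_, fun hpW ↦ Ideal.subset_span hpW⟩
  simpa [(hφ p).2 hpW] using h p hp

theorem ideal_span_submodule_span (s : Set (MvPolynomial (Fin n) F)) :
    Ideal.span (span F s : Set (MvPolynomial (Fin n) F)) = Ideal.span s :=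
  Submodule.span_span_of_tower F (MvPolynomial (Fin n) F) s

theorem span_singleton_le_homogeneousSubmodule {ℓ : MvPolynomial (Fin n) F}
    (hℓ : ℓ.IsHomogeneous 1) : span F {ℓ} ≤ homogeneousSubmodule (Fin n) F 1 :=
  (span_singleton_le_iff_mem _ _).2 hℓ

theorem dvd_iff_mem_span_singleton {ℓ p : MvPolynomial (Fin n) F} (hℓ : ℓ.IsHomogeneous 1)
    (hp : p.IsHomogeneous 1) : ℓ ∣ p ↔ p ∈ span F {ℓ} := by
  rw [← mem_ideal_span_iff_of_isHomogeneous_one (span_singleton_le_homogeneousSubmodule hℓ) hp,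
    ideal_span_submodule_span, Ideal.mem_span_singleton]

theorem totalDegree_le_of_forall_isHomogeneous
    {φ : MvPolynomial (Fin n) F →ₐ[F] MvPolynomial (Fin n) F}
    (hφ : ∀ m p, p.IsHomogeneous m → (φ p).IsHomogeneous m) (p : MvPolynomial (Fin n) F) :
    (φ p).totalDegree ≤ p.totalDegree := by
  conv_lhs => rw [← sum_homogeneousComponent p, map_sum]
  refine totalDegree_finsetSum_le fun i hi ↦ ?_
  exact (hφ _ _ (homogeneousComponent_isHomogeneous i p)).totalDegree_le.trans
    (Nat.lt_succ_iff.1 (Finset.mem_range.1 hi))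

end MvPolynomial

section LinearForms

open Module Submodule

variable {F : Type*} [Field F] {n : ℕ}

theorem IsLinearForm.prime {ℓ : MvPolynomial (Fin n) F} (hℓ : IsLinearForm ℓ) : Prime ℓ := by
  rw [← Ideal.span_singleton_prime hℓ.1, ← ideal_span_submodule_span]
  exact isPrime_span_of_le_homogeneousSubmodule (span_singleton_le_homogeneousSubmodule hℓ.2)

theorem IsLinearForm.span_eq_of_mem {ℓ p : MvPolynomial (Fin n) F} (hp : IsLinearForm p)
    (h : p ∈ span F {ℓ}) : span F {p} = span F {ℓ} := by
  obtain ⟨c, rfl⟩ := mem_span_singleton.1 h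
  have hc : c ≠ 0 := by
    rintro rfl
    exact hp.1 (zero_smul _ _)
  exact span_singleton_smul_eq hc.isUnit ℓ

theorem isHomogeneous_multiset_prod_of_isLinearForm {L : Multiset (MvPolynomial (Fin n) F)}
    (hL : ∀ p ∈ L, IsLinearForm p) : L.prod.IsHomogeneous L.card := by
  induction L using Multiset.induction_on with
  | empty => simpa using isHomogeneous_one (Fin n) F
  | cons a s ih =>
    rw [Multiset.prod_cons, Multiset.card_cons, add_comm]
    exact (hL a (Multiset.mem_cons_self a s)).2.mul
      (ih fun p hp ↦ hL p (Multiset.mem_cons_of_mem hp))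

/-- The linear factors of a product of `m` linear forms are controlled by a set of at most `m`
linear forms. -/
theorem IsProdLinearForms.exists_finset {T : MvPolynomial (Fin n) F} {m : ℕ}
    (hT : IsProdLinearForms T) (hm : T.IsHomogeneous m) :
    ∃ A : Finset (MvPolynomial (Fin n) F), A.card ≤ m ∧ (∀ a ∈ A, IsLinearForm a ∧ a ∣ T) ∧
      ∀ J : Ideal (MvPolynomial (Fin n) F), J.IsPrime → T ∈ J → ∃ a ∈ A, a ∈ J := by
  classical
  obtain ⟨c, L, hc, hL, rfl⟩ := hT
  have hunit : IsUnit (C c : MvPolynomial (Fin n) F) := hc.isUnit.map C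
  refine ⟨L.toFinset, ?_, fun a ha ↦ ?_, fun J hJ hTJ ↦ ?_⟩
  · have h0 : L.prod ≠ 0 := Multiset.prod_ne_zero fun h ↦ (hL 0 h).1 rfl
    have hcard : (c • L.prod).IsHomogeneous L.card := by
      rw [smul_eq_C_mul]
      exact (isHomogeneous_multiset_prod_of_isLinearForm hL).C_mul c
    rw [hm.inj_right hcard (smul_ne_zero hc h0)]
    exact Multiset.toFinset_card_le L
  · rw [Multiset.mem_toFinset] at ha
    rw [smul_eq_C_mul]
    exact ⟨hL a ha, (Multiset.dvd_prod ha).mul_left _⟩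
  · rw [smul_eq_C_mul, Ideal.unit_mul_mem_iff_mem J hunit, hJ.multiset_prod_mem_iff_exists_mem]
      at hTJ
    obtain ⟨a, ha, haJ⟩ := hTJ
    exact ⟨a, Multiset.mem_toFinset.2 ha, haJ⟩

theorem NoLinearFactor.dvd_of_dvd_mul {h G q : MvPolynomial (Fin n) F} (hh : NoLinearFactor h)
    (hG : IsProdLinearForms G) (hdvd : h ∣ G * q) : h ∣ q := by
  obtain ⟨c, L, hc, hL, rfl⟩ := hG
  have hunit : IsUnit (C c : MvPolynomial (Fin n) F) := hc.isUnit.map C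
  rw [smul_eq_C_mul, mul_assoc, hunit.dvd_mul_left] at hdvd
  induction L using Multiset.induction_on with
  | empty => simpa using hdvd
  | cons a s ih =>
    have ha := hL a (Multiset.mem_cons_self a s)
    refine ih (fun p hp ↦ hL p (Multiset.mem_cons_of_mem hp)) ?_
    obtain ⟨k, hk⟩ := hdvd
    rw [Multiset.prod_cons, mul_assoc] at hk
    obtain ⟨k', rfl⟩ := (ha.prime.dvd_or_dvd (Dvd.intro _ hk)).resolve_left (hh a ha)
    exact ⟨k', mul_left_cancel₀ ha.1 (by rw [hk]; ring)⟩

/-- A polynomial `h` vanishes on at most `deg h` codimension-2 subspaces of a hyperplane on which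
it does not vanish. -/
theorem card_le_totalDegree_of_line_le {h : MvPolynomial (Fin n) F}
    {U : Submodule F (MvPolynomial (Fin n) F)} (hU : finrank F U = 1)
    (hU1 : U ≤ homogeneousSubmodule (Fin n) F 1)
    (hhU : h ∉ Ideal.span (U : Set (MvPolynomial (Fin n) F)))
    (s : Finset (Submodule F (MvPolynomial (Fin n) F)))
    (hs1 : ∀ I ∈ s, I ≤ homogeneousSubmodule (Fin n) F 1)
    (hs2 : ∀ I ∈ s, finrank F I = 2)
    (hsU : ∀ I ∈ s, U ≤ I)
    (hsh : ∀ I ∈ s, h ∈ Ideal.span (I : Set (MvPolynomial (Fin n) F))) :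
    s.card ≤ h.totalDegree := by
  classical
  obtain ⟨φ, hφhom, hφker, hφsub⟩ := exists_substitution_of_le_homogeneousSubmodule hU1
  have hφU (p : MvPolynomial (Fin n) F) (hp : p ∈ U) : φ p = 0 := (hφker p).2 (Ideal.subset_span hp)
  have hex : ∀ I ∈ s, ∃ u, IsLinearForm u ∧ U ⊔ span F {u} = I ∧ u ∣ φ h := by
    intro I hI
    obtain ⟨w, hwI, hwU⟩ : ∃ w ∈ I, w ∉ U := by
      by_contra! hcon
      rw [le_antisymm (hsU I hI) hcon, hs2 I hI] at hU
      omega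
    have hwsub := hφsub w (hs1 I hI hwI)
    have huI : φ w ∈ I := by simpa using sub_mem hwI (hsU I hI hwsub)
    have huU : φ w ∉ U := fun hu ↦ hwU (by simpa using add_mem hwsub hu)
    have hφφ : φ (φ w) = φ w := by
      have := hφU _ hwsub
      rw [map_sub, sub_eq_zero] at this
      exact this.symm
    have hIeq := sup_span_singleton_eq_of_finrank_eq_two (hs2 I hI) hU (hsU I hI) huI huU
    refine ⟨φ w, ⟨fun h0 ↦ huU (h0 ▸ U.zero_mem), hs1 I hI huI⟩, hIeq, ?_⟩
    have hle : Ideal.span (I : Set (MvPolynomial (Fin n) F)) ≤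
        (Ideal.span {φ w}).comap φ.toRingHom := by
      rw [Ideal.span_le, ← hIeq]
      intro p hp
      obtain ⟨y, hy, z, hz, rfl⟩ := mem_sup.1 hp
      obtain ⟨c, rfl⟩ := mem_span_singleton.1 hz
      rw [SetLike.mem_coe, Ideal.mem_comap, Ideal.mem_span_singleton]
      refine ⟨C c, ?_⟩
      simp [hφU y hy, hφφ, smul_eq_C_mul, mul_comm]
    exact Ideal.mem_span_singleton.1 (hle (hsh I hI))
  choose! u hu hIu hudvd using hex
  have hprod : ∏ I ∈ s, u I ∣ φ h := by
    refine Finset.prod_dvd_of_isRelPrime (fun I hI J hJ hIJ ↦ ?_) hudvd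
    rw [Function.onFun, (hu I hI).prime.irreducible.isRelPrime_iff_not_dvd,
      dvd_iff_mem_span_singleton (hu I hI).2 (hu J hJ).2]
    intro hmem
    exact hIJ (by rw [← hIu I hI, ← hIu J hJ, (hu J hJ).span_eq_of_mem hmem])
  have hφh : φ h ≠ 0 := fun h0 ↦ hhU ((hφker h).1 h0)
  obtain ⟨q, hq⟩ := hprod
  have hprod0 : ∏ I ∈ s, u I ≠ 0 := Finset.prod_ne_zero_iff.2 fun I hI ↦ (hu I hI).1
  have hq0 : q ≠ 0 := fun h0 ↦ hφh (by rw [hq, h0, mul_zero])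
  have hdeg : (∏ I ∈ s, u I).totalDegree = s.card := by
    have := IsHomogeneous.prod s u (fun _ ↦ 1) fun I hI ↦ (hu I hI).2
    rw [this.totalDegree hprod0, Finset.sum_const, smul_eq_mul, mul_one]
  have := totalDegree_le_of_forall_isHomogeneous hφhom h
  rw [hq, totalDegree_mul_of_isDomain hprod0 hq0, hdeg] at this
  omega

theorem span_pair_le_homogeneousSubmodule {a b : MvPolynomial (Fin n) F}
    (ha : a.IsHomogeneous 1) (hb : b.IsHomogeneous 1) :
    span F {a, b} ≤ homogeneousSubmodule (Fin n) F 1 := by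
  rw [span_le, Set.insert_subset_iff, Set.singleton_subset_iff]
  exact ⟨ha, hb⟩

/-- If `T₁ + T₂` vanishes modulo a space `I` of linear forms, then modulo `I` every linear factor
`a` of `T₁` is matched by a linear factor `b` of `T₂`. -/
theorem exists_mem_span_pair_of_add_mem {B : Finset (MvPolynomial (Fin n) F)}
    {T₁ T₂ a : MvPolynomial (Fin n) F}
    (hB : ∀ b ∈ B, IsLinearForm b)
    (hBT : ∀ J : Ideal (MvPolynomial (Fin n) F), J.IsPrime → T₂ ∈ J → ∃ b ∈ B, b ∈ J)
    (hAB : ∀ b ∈ B, ¬ a ∣ b)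
    {I : Submodule F (MvPolynomial (Fin n) F)} (hI : I ≤ homogeneousSubmodule (Fin n) F 1)
    (hTI : T₁ + T₂ ∈ Ideal.span (I : Set (MvPolynomial (Fin n) F)))
    (ha : IsLinearForm a) (haT : a ∣ T₁) :
    ∃ b ∈ B, ∃ w ∈ I, w ∈ span F {a, b} ∧ w ≠ 0 := by
  have hW : I ⊔ span F {a} ≤ homogeneousSubmodule (Fin n) F 1 :=
    sup_le hI (span_singleton_le_homogeneousSubmodule ha.2)
  have haW : a ∈ I ⊔ span F {a} := mem_sup_right (mem_span_singleton_self a)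
  have hT₁ : T₁ ∈ Ideal.span (↑(I ⊔ span F {a}) : Set (MvPolynomial (Fin n) F)) :=
    Ideal.mem_of_dvd _ haT (Ideal.subset_span haW)
  have hT : T₁ + T₂ ∈ Ideal.span (↑(I ⊔ span F {a}) : Set (MvPolynomial (Fin n) F)) :=
    Ideal.span_mono (SetLike.coe_subset_coe.2 le_sup_left) hTI
  obtain ⟨b, hb, hbJ⟩ := hBT _ (isPrime_span_of_le_homogeneousSubmodule hW)
    ((Ideal.add_mem_iff_right _ hT₁).1 hT)
  rw [mem_ideal_span_iff_of_isHomogeneous_one hW (hB b hb).2] at hbJ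
  obtain ⟨w, hw, z, hz, hwz⟩ := mem_sup.1 hbJ
  obtain ⟨c, rfl⟩ := mem_span_singleton.1 hz
  refine ⟨b, hb, w, hw, mem_span_pair.2 ⟨-c, 1, ?_⟩, fun hw0 ↦ hAB b hb ?_⟩
  · rw [← hwz]
    module
  · rw [← hwz, hw0, zero_add, smul_eq_C_mul]
    exact dvd_mul_left _ _

end LinearForms

/-- The planes of linear forms modulo which `h` vanishes, for `h` a divisor of `T₁ + T₂` without
linear factors, are few. -/
theorem card_vanishing_planes_le {F : Type*} [Field F] {n m : ℕ}
    {T₁ T₂ h : MvPolynomial (Fin n) F}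
    (hT₁ : IsProdLinearForms T₁) (hT₂ : IsProdLinearForms T₂)
    (hT₁hom : T₁.IsHomogeneous m) (hT₂hom : T₂.IsHomogeneous m)
    (hgcd : ∀ ℓ : MvPolynomial (Fin n) F, IsLinearForm ℓ → ℓ ∣ T₁ → ¬ ℓ ∣ T₂)
    (hrank : 5 ≤ Module.finrank F
      ↥(Submodule.span F {ℓ : MvPolynomial (Fin n) F | IsLinearForm ℓ ∧ ℓ ∣ T₁ * T₂}))
    (hh : NoLinearFactor h) (hdvd : h ∣ T₁ + T₂)
    (s : Finset (Submodule F (MvPolynomial (Fin n) F)))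
    (hs1 : ∀ I ∈ s, I ≤ homogeneousSubmodule (Fin n) F 1)
    (hs2 : ∀ I ∈ s, Module.finrank F I = 2)
    (hsh : ∀ I ∈ s, h ∈ Ideal.span (I : Set (MvPolynomial (Fin n) F))) :
    s.card ≤ (m ^ 4 + m ^ 6) * m := by
  classical
  obtain ⟨A, hAm, hA, hAJ⟩ := hT₁.exists_finset hT₁hom
  obtain ⟨B, hBm, hB, hBJ⟩ := hT₂.exists_finset hT₂hom
  set S := Submodule.span F {ℓ : MvPolynomial (Fin n) F | IsLinearForm ℓ ∧ ℓ ∣ T₁ * T₂}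
  have hS : S ≤ Submodule.span F (↑(A ∪ B) : Set (MvPolynomial (Fin n) F)) := by
    refine Submodule.span_le.2 ?_
    rintro ℓ ⟨hℓ, hℓT⟩
    have hprime : (Ideal.span {ℓ}).IsPrime := (Ideal.span_singleton_prime hℓ.1).2 hℓ.prime
    have hmem (p : MvPolynomial (Fin n) F) (hp : IsLinearForm p) (hpℓ : p ∈ Ideal.span {ℓ}) :
        ℓ ∈ Submodule.span F {p} := by
      rw [Ideal.mem_span_singleton, dvd_iff_mem_span_singleton hℓ.2 hp.2] at hpℓ
      rw [hp.span_eq_of_mem hpℓ]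
      exact Submodule.mem_span_singleton_self ℓ
    rw [SetLike.mem_coe]
    obtain hT | hT := hprime.mem_or_mem (Ideal.mem_span_singleton.2 hℓT)
    · obtain ⟨a, ha, haJ⟩ := hAJ _ hprime hT
      exact Submodule.span_mono (by simpa using Or.inl ha) (hmem a (hA a ha).1 haJ)
    · obtain ⟨b, hb, hbJ⟩ := hBJ _ hprime hT
      exact Submodule.span_mono (by simpa using Or.inr hb) (hmem b (hB b hb).1 hbJ)
  let P (x : MvPolynomial (Fin n) F × MvPolynomial (Fin n) F) : Submodule F _ :=
    Submodule.span F {x.1, x.2}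
  have hPhom {x : MvPolynomial (Fin n) F × MvPolynomial (Fin n) F} (hx : x ∈ A ×ˢ B) :
      P x ≤ homogeneousSubmodule (Fin n) F 1 := by
    rw [Finset.mem_product] at hx
    exact span_pair_le_homogeneousSubmodule (hA _ hx.1).1.2 (hB _ hx.2).1.2
  let D := A ×ˢ B
  have hD : D.card ≤ m ^ 2 := by
    rw [Finset.card_product, sq]
    exact Nat.mul_le_mul hAm hBm
  let N := (D ×ˢ D).image (fun x ↦ P x.1 ⊓ P x.2) ∪
    (D ×ˢ D ×ˢ D).image (fun x ↦ (P x.1 ⊔ P x.2.1) ⊓ P x.2.2)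
  have hN : N.card ≤ m ^ 4 + m ^ 6 := by
    refine (Finset.card_union_le _ _).trans (add_le_add ?_ ?_)
    · refine Finset.card_image_le.trans ?_
      rw [Finset.card_product]
      calc D.card * D.card ≤ m ^ 2 * m ^ 2 := by gcongr
        _ = m ^ 4 := by ring
    · refine Finset.card_image_le.trans ?_
      rw [Finset.card_product D, Finset.card_product D]
      calc D.card * (D.card * D.card) ≤ m ^ 2 * (m ^ 2 * m ^ 2) := by gcongr
        _ = m ^ 6 := by ring
  have hNhom : ∀ U ∈ N, U ≤ homogeneousSubmodule (Fin n) F 1 := by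
    intro U hU
    obtain hU | hU := Finset.mem_union.1 hU <;> obtain ⟨x, hx, rfl⟩ := Finset.mem_image.1 hU <;>
      rw [Finset.mem_product] at hx
    · exact inf_le_left.trans (hPhom hx.1)
    · exact inf_le_right.trans (hPhom (Finset.mem_product.1 hx.2).2)
  have hnot : ∀ a ∈ A, ∀ b ∈ B, ¬ a ∣ b := fun a ha b hb hab ↦
    hgcd a (hA a ha).1 (hA a ha).2 (hab.trans (hB b hb).2)
  have hnot' : ∀ b ∈ B, ∀ a ∈ A, ¬ b ∣ a := fun b hb a ha hba ↦
    hgcd b (hB b hb).1 (hba.trans (hA a ha).2) (hB b hb).2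
  have hcover : ∀ I ∈ s, ∃ U ∈ N, Module.finrank F U = 1 ∧ U ≤ I := by
    intro I hI
    have hTI : T₁ + T₂ ∈ Ideal.span (I : Set (MvPolynomial (Fin n) F)) :=
      Ideal.mem_of_dvd _ hdvd (hsh I hI)
    let R : Set (MvPolynomial (Fin n) F × MvPolynomial (Fin n) F) :=
      {x | x ∈ D ∧ ∃ w ∈ I, w ∈ P x ∧ w ≠ 0}
    have hR : ∀ x ∈ R, ∀ p, p = x.1 ∨ p = x.2 → p ∈ ⨆ x ∈ R, P x := by
      intro x hx p hp
      exact (le_iSup₂ (f := fun x (_ : x ∈ R) ↦ P x) x hx) (Submodule.subset_span hp)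
    have hSR : S ≤ ⨆ x ∈ R, P x := by
      refine hS.trans (Submodule.span_le.2 fun p hp ↦ ?_)
      obtain ha | hb := Finset.mem_union.1 (Finset.mem_coe.1 hp)
      · obtain ⟨b, hb, hw⟩ := exists_mem_span_pair_of_add_mem (fun b hb ↦ (hB b hb).1) hBJ
          (hnot p ha) (hs1 I hI) hTI (hA p ha).1 (hA p ha).2
        exact hR (p, b) ⟨Finset.mk_mem_product ha hb, hw⟩ p (Or.inl rfl)
      · obtain ⟨a, ha, hw⟩ := exists_mem_span_pair_of_add_mem (fun a ha ↦ (hA a ha).1) hAJ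
          (hnot' p hb) (hs1 I hI) (add_comm T₁ T₂ ▸ hTI) (hB p hb).1 (hB p hb).2
        rw [Set.pair_comm] at hw
        exact hR (a, p) ⟨Finset.mk_mem_product ha hb, hw⟩ p (Or.inr rfl)
    obtain ⟨x, hx, y, hy, z, hz, hU | hU⟩ := exists_line_le_of_meets_planes P
      (fun x ↦ Submodule.finrank_span_pair_le x.1 x.2) (hs2 I hI) R (fun x hx ↦ hx.2) hrank hSR
    · exact ⟨_, Finset.mem_union_left _ (Finset.mem_image.2
        ⟨(x, y), Finset.mk_mem_product hx.1 hy.1, rfl⟩), hU⟩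
    · exact ⟨_, Finset.mem_union_right _ (Finset.mem_image.2 ⟨(x, y, z), Finset.mk_mem_product hx.1
        (Finset.mk_mem_product hy.1 hz.1), rfl⟩), hU⟩
  let t (U : Submodule F (MvPolynomial (Fin n) F)) :=
    s.filter fun I ↦ Module.finrank F U = 1 ∧ U ≤ I
  have hdeg : h.totalDegree ≤ m := by
    obtain ⟨k, hk⟩ := hdvd
    by_cases h0 : h * k = 0
    · rw [h0] at hk
      have hS0 : S ≤ ⊥ := Submodule.span_le.2 fun ℓ hℓ ↦ by
        obtain hℓT | hℓT := hℓ.1.prime.dvd_or_dvd hℓ.2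
        · exact absurd (eq_neg_of_add_eq_zero_right hk ▸ (dvd_neg.2 hℓT)) (hgcd ℓ hℓ.1 hℓT)
        · exact absurd hℓT
            (hgcd ℓ hℓ.1 (eq_neg_of_add_eq_zero_left hk ▸ (dvd_neg.2 hℓT)))
      rw [le_bot_iff.1 hS0, finrank_bot] at hrank
      omega
    · have hle := (hT₁hom.add hT₂hom).totalDegree_le
      rw [hk, totalDegree_mul_of_isDomain (left_ne_zero_of_mul h0) (right_ne_zero_of_mul h0)]
        at hle
      omega
  have ht : ∀ U ∈ N, (t U).card ≤ m := by
    intro U hU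
    by_cases hU1 : Module.finrank F U = 1
    · have : FiniteDimensional F U := Module.finite_of_finrank_pos (by omega)
      have hUbot : U ≠ ⊥ := by
        rintro rfl
        simp at hU1
      obtain ⟨ℓ, hℓU, hℓ0⟩ := U.ne_bot_iff.1 hUbot
      have hUℓ := Submodule.eq_span_singleton_of_finrank_lt_two (by omega) hℓU hℓ0
      have hhU : h ∉ Ideal.span (U : Set (MvPolynomial (Fin n) F)) := by
        rw [hUℓ, ideal_span_submodule_span, Ideal.mem_span_singleton]
        exact hh ℓ ⟨hℓ0, hNhom U hU hℓU⟩
      have hts {I : Submodule F (MvPolynomial (Fin n) F)} (hI : I ∈ t U) : I ∈ s ∧ U ≤ I :=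
        ⟨(Finset.mem_filter.1 hI).1, (Finset.mem_filter.1 hI).2.2⟩
      exact (card_le_totalDegree_of_line_le hU1 (hNhom U hU) hhU (t U)
        (fun I hI ↦ hs1 I (hts hI).1) (fun I hI ↦ hs2 I (hts hI).1) (fun I hI ↦ (hts hI).2)
        (fun I hI ↦ hsh I (hts hI).1)).trans hdeg
    · simp [t, hU1]
  calc s.card ≤ (N.biUnion t).card := by
        refine Finset.card_le_card fun I hI ↦ ?_
        obtain ⟨U, hU, hUI⟩ := hcover I hI
        exact Finset.mem_biUnion.2 ⟨U, hU, Finset.mem_filter.2 ⟨hI, hUI⟩⟩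
    _ ≤ N.card * m := Finset.card_biUnion_le_card_mul _ _ _ ht
    _ ≤ (m ^ 4 + m ^ 6) * m := by gcongr

/-- Proposition 1, Part 1: if `f = G·(T₁+T₂)` with `G, T₁, T₂` products of linear forms,
`T₁, T₂` homogeneous of equal degree `m ≤ d`, with no common linear factor, and the linear
factors of `T₁·T₂` span a space of dimension at least 5, then
`|S(NonLin(f))| ≤ 3·d⁷`. -/
theorem count_vanishing_codim2_subspaces
    {F : Type*} [Field F] [Fintype F] {n d m : ℕ}
    (G T₁ T₂ f h : MvPolynomial (Fin n) F)
    (hd : 1 ≤ d) (hmd : m ≤ d)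
    (hG : IsProdLinearForms G) (hT₁ : IsProdLinearForms T₁) (hT₂ : IsProdLinearForms T₂)
    (hT₁hom : T₁.IsHomogeneous m) (hT₂hom : T₂.IsHomogeneous m)
    (hgcd : ∀ ℓ : MvPolynomial (Fin n) F, IsLinearForm ℓ → ℓ ∣ T₁ → ¬ ℓ ∣ T₂)
    (hrank : 5 ≤ Module.finrank F
      ↥(Submodule.span F {ℓ : MvPolynomial (Fin n) F | IsLinearForm ℓ ∧ ℓ ∣ T₁ * T₂}))
    (hf : f = G * (T₁ + T₂)) (hh : IsNonLinPart f h) :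
    (vanishCodim2 h).ncard ≤ 3 * d ^ 7 := by
  have hdvd : h ∣ T₁ + T₂ := by
    obtain ⟨hno, L, -, hL⟩ := hh
    exact hno.dvd_of_dvd_mul hG (hf ▸ hL ▸ dvd_mul_left h L)
  have hex : ∀ W ∈ vanishCodim2 h, ∃ I : Submodule F (MvPolynomial (Fin n) F),
      I ≤ homogeneousSubmodule (Fin n) F 1 ∧ Module.finrank F I = 2 ∧
      h ∈ Ideal.span (I : Set (MvPolynomial (Fin n) F)) ∧ W = {a | ∀ p ∈ I, eval a p = 0} := by
    rintro W ⟨ℓ₁, ℓ₂, h₁, h₂, hli, rfl, hmem⟩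
    refine ⟨Submodule.span F {ℓ₁, ℓ₂}, span_pair_le_homogeneousSubmodule h₁.2 h₂.2, ?_,
      by rwa [ideal_span_submodule_span], ?_⟩
    · have := finrank_span_eq_card (R := F) hli
      rwa [Matrix.range_cons_cons_empty, Fintype.card_fin] at this
    · ext a
      refine ⟨fun ⟨ha₁, ha₂⟩ p hp ↦ ?_, fun ha ↦ ⟨ha _ (Submodule.subset_span (Or.inl rfl)),
        ha _ (Submodule.subset_span (Or.inr rfl))⟩⟩
      obtain ⟨c, e, rfl⟩ := Submodule.mem_span_pair.1 hp
      simp [smul_eval, ha₁, ha₂]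
  choose! I hI1 hI2 hIh hIW using hex
  classical
  have hfin : (vanishCodim2 h).Finite := Set.toFinite _
  have hinj : Set.InjOn I hfin.toFinset := by
    intro W hW W' hW' hWW'
    rw [Finset.mem_coe, hfin.mem_toFinset] at hW hW'
    rw [hIW W hW, hIW W' hW', hWW']
  rw [Set.ncard_eq_toFinset_card _ hfin, ← Finset.card_image_of_injOn hinj]
  have himage {q : Submodule F (MvPolynomial (Fin n) F) → Prop}
      (hq : ∀ W ∈ vanishCodim2 h, q (I W)) : ∀ J ∈ hfin.toFinset.image I, q J := by
    simpa [Finset.forall_mem_image] using hq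
  calc _ ≤ (m ^ 4 + m ^ 6) * m := card_vanishing_planes_le hT₁ hT₂ hT₁hom hT₂hom hgcd hrank hh.1
        hdvd _ (himage hI1) (himage hI2) (himage hIh)
    _ ≤ (d ^ 6 + d ^ 6) * d := by
      have : m ^ 4 ≤ d ^ 6 :=
        (Nat.pow_le_pow_left hmd 4).trans (Nat.pow_le_pow_right hd (by norm_num))
      gcongr
    _ = 2 * d ^ 7 := by ring
    _ ≤ 3 * d ^ 7 := by omega
end

section
/- Let f = G·(T_1 + T_2), where G, T_1, T_2 ∈ F[x_1,…,x_n] are products of linear forms, T_1 and T_2 are homogeneous of equal degree at most d (with d ≥ 1), and T_1 and T_2 have no common linear factor (gcd(T_1,T_2) = 1). Then the number of codimension-2 subspaces W ∈ S(NonLin(f)) on which both T_1 and T_2 vanish (i.e. both T_1 and T_2 lie in the ideal of W) is at most d². -/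
open MvPolynomial

/-- If a product of linear forms lies in the ideal `(ℓ₁, ℓ₂)`, then one of the factors is an
`F`-linear combination of `ℓ₁` and `ℓ₂`. -/
theorem exists_mem_span_pair_of_prod_mem {F : Type*} [Field F] {n : ℕ}
    {ℓ₁ ℓ₂ : MvPolynomial (Fin n) F} (h₁ : IsLinearForm ℓ₁) (h₂ : IsLinearForm ℓ₂)
    {L : Multiset (MvPolynomial (Fin n) F)} (hL : ∀ p ∈ L, IsLinearForm p)
    (hmem : L.prod ∈ Ideal.span {ℓ₁, ℓ₂}) :
    ∃ p ∈ L, p ∈ Submodule.span F {ℓ₁, ℓ₂} := by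
  set U := Submodule.span F {ℓ₁, ℓ₂} with hU
  obtain ⟨g, hg⟩ := U.mkQ.exists_rightInverse_of_surjective U.range_mkQ
  let φ : MvPolynomial (Fin n) F →ₐ[F] MvPolynomial (Fin n) F :=
    aeval fun i => g (U.mkQ (X i))
  have hφ : ∀ p, IsLinearForm p → φ p = g (U.mkQ p) := by
    intro p hp
    have hp' : p ∈ Submodule.span F (Set.range (X : Fin n → MvPolynomial (Fin n) F)) := by
      rw [← homogeneousSubmodule_one_eq_span_X]
      exact hp.2
    refine LinearMap.eqOn_span (f := φ.toLinearMap) (g := g ∘ₗ U.mkQ) ?_ hp'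
    rintro _ ⟨i, rfl⟩
    simp [φ]
  have hzero : ∀ p, IsLinearForm p → p ∈ U → φ p = 0 := by
    intro p hp hpU
    rw [hφ p hp, Submodule.mkQ_apply, (Submodule.Quotient.mk_eq_zero U).2 hpU, map_zero]
  have hker : Ideal.span {ℓ₁, ℓ₂} ≤ RingHom.ker φ := by
    rw [Ideal.span_le]
    rintro p (rfl | rfl)
    · exact hzero _ h₁ (Submodule.subset_span (by simp))
    · exact hzero _ h₂ (Submodule.subset_span (by simp))
  have hprod : φ L.prod = 0 := hker hmem
  rw [map_multiset_prod, Multiset.prod_eq_zero_iff, Multiset.mem_map] at hprod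
  obtain ⟨p, hpL, hp⟩ := hprod
  refine ⟨p, hpL, ?_⟩
  rw [hφ p (hL p hpL)] at hp
  have hgp := LinearMap.congr_fun hg (U.mkQ p)
  rw [LinearMap.comp_apply, hp, map_zero, LinearMap.id_apply] at hgp
  exact (Submodule.Quotient.mk_eq_zero U).1 hgp.symm

/-- The number of linear factors of a homogeneous product of linear forms is its degree. -/
theorem card_eq_of_isHomogeneous_smul_prod {F : Type*} [Field F] {n m : ℕ} {c : F}
    {L : Multiset (MvPolynomial (Fin n) F)} (hc : c ≠ 0) (hL : ∀ p ∈ L, IsLinearForm p)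
    (hm : (c • L.prod).IsHomogeneous m) : Multiset.card L = m := by
  have hprod : ∀ L : Multiset (MvPolynomial (Fin n) F), (∀ p ∈ L, IsLinearForm p) →
      L.prod.IsHomogeneous (Multiset.card L) := by
    intro L
    induction L using Multiset.induction_on with
    | empty => intro _; simpa using isHomogeneous_one (Fin n) F
    | cons p L ih =>
      intro hL
      rw [Multiset.prod_cons, Multiset.card_cons, add_comm]
      exact (hL p (Multiset.mem_cons_self p L)).2.mul
        (ih fun q hq => hL q (Multiset.mem_cons_of_mem hq))
  have hne : c • L.prod ≠ 0 :=
    smul_ne_zero hc (Multiset.prod_ne_zero fun h0 => (hL 0 h0).1 rfl)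
  refine IsHomogeneous.inj_right ?_ hm hne
  rw [smul_eq_C_mul]
  simpa using (isHomogeneous_C (Fin n) c).mul (hprod L hL)

/-- Two elements `p`, `q` of the `F`-span of `ℓ₁`, `ℓ₂` with `q ≠ 0` and `q ∤ p` have the same
common zeros as `ℓ₁` and `ℓ₂`. -/
theorem setOf_eval_eq_zero_of_mem_span_pair {F : Type*} [Field F] {n : ℕ}
    {ℓ₁ ℓ₂ p q : MvPolynomial (Fin n) F} (hq0 : q ≠ 0) (hqp : ¬ q ∣ p)
    (hp : p ∈ Submodule.span F {ℓ₁, ℓ₂}) (hq : q ∈ Submodule.span F {ℓ₁, ℓ₂}) :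
    {a : Fin n → F | eval a ℓ₁ = 0 ∧ eval a ℓ₂ = 0} =
      {a : Fin n → F | eval a p = 0 ∧ eval a q = 0} := by
  obtain ⟨a, b, rfl⟩ := Submodule.mem_span_pair.1 hp
  obtain ⟨c, e, rfl⟩ := Submodule.mem_span_pair.1 hq
  have hdet : a * e - b * c ≠ 0 := by
    intro hdet
    apply hqp
    by_cases he : e = 0
    · have hc : c ≠ 0 := by
        rintro rfl
        simp [he] at hq0
      have hb : b = 0 := by
        rw [he] at hdet
        simpa [hc] using hdet
      exact ⟨C (a / c), by
        simp only [hb, he, zero_smul, add_zero, smul_eq_C_mul]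
        rw [mul_right_comm, ← C_mul, mul_div_cancel₀ _ hc]⟩
    · refine ⟨C (b / e), ?_⟩
      have ha : a = c * (b / e) := by
        field_simp
        linear_combination hdet
      have hb : b = e * (b / e) := by field_simp
      rw [add_mul, smul_eq_C_mul, smul_eq_C_mul, smul_eq_C_mul, smul_eq_C_mul,
        mul_right_comm, ← C_mul, mul_right_comm (C e), ← C_mul, ← ha, ← hb]
  ext x
  simp only [Set.mem_ofPred_eq, map_add, smul_eval]
  constructor
  · rintro ⟨h1, h2⟩
    simp [h1, h2]
  · rintro ⟨h1, h2⟩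
    exact ⟨mul_left_cancel₀ hdet (by linear_combination e * h1 - b * h2),
      mul_left_cancel₀ hdet (by linear_combination a * h2 - c * h1)⟩

/-- Lemma (size bound), Part 1: the number of codimension-2 subspaces
`W ∈ S(NonLin(f))` on which both `T₁` and `T₂` vanish is at most `d²`. -/
theorem count_codim2_both_gates_vanish
    {F : Type*} [Field F] [Fintype F] {n d m : ℕ}
    (G T₁ T₂ f h : MvPolynomial (Fin n) F)
    (hd : 1 ≤ d) (hmd : m ≤ d)
    (hG : IsProdLinearForms G) (hT₁ : IsProdLinearForms T₁) (hT₂ : IsProdLinearForms T₂)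
    (hT₁hom : T₁.IsHomogeneous m) (hT₂hom : T₂.IsHomogeneous m)
    (hgcd : ∀ ℓ : MvPolynomial (Fin n) F, IsLinearForm ℓ → ℓ ∣ T₁ → ¬ ℓ ∣ T₂)
    (hf : f = G * (T₁ + T₂)) (hh : IsNonLinPart f h) :
    {W : Set (Fin n → F) | ∃ ℓ₁ ℓ₂ : MvPolynomial (Fin n) F,
      IsLinearForm ℓ₁ ∧ IsLinearForm ℓ₂ ∧ LinearIndependent F ![ℓ₁, ℓ₂] ∧
      W = {a : Fin n → F | eval a ℓ₁ = 0 ∧ eval a ℓ₂ = 0} ∧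
      h ∈ Ideal.span {ℓ₁, ℓ₂} ∧
      T₁ ∈ Ideal.span {ℓ₁, ℓ₂} ∧ T₂ ∈ Ideal.span {ℓ₁, ℓ₂}}.ncard ≤ d ^ 2 := by
  classical
  obtain ⟨c₁, L₁, hc₁, hL₁, rfl⟩ := hT₁
  obtain ⟨c₂, L₂, hc₂, hL₂, rfl⟩ := hT₂
  have hcard₁ := card_eq_of_isHomogeneous_smul_prod hc₁ hL₁ hT₁hom
  have hcard₂ := card_eq_of_isHomogeneous_smul_prod hc₂ hL₂ hT₂hom
  have hdvd : ∀ (c : F) (L : Multiset (MvPolynomial (Fin n) F)), ∀ p ∈ L,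
      p ∣ c • L.prod := fun c L p hp => by
    rw [smul_eq_C_mul]
    exact (Multiset.dvd_prod hp).mul_left _
  have hunsmul : ∀ {c : F} {p : MvPolynomial (Fin n) F}
      {I : Ideal (MvPolynomial (Fin n) F)}, c ≠ 0 → c • p ∈ I → p ∈ I := by
    intro c p I hc hp
    simpa [smul_smul, hc] using I.smul_of_tower_mem c⁻¹ hp
  let Z : MvPolynomial (Fin n) F × MvPolynomial (Fin n) F → Set (Fin n → F) :=
    fun r => {a | eval a r.1 = 0 ∧ eval a r.2 = 0}
  calc _ ≤ (((L₁.toFinset ×ˢ L₂.toFinset).image Z : Finset (Set (Fin n → F))) :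
          Set (Set (Fin n → F))).ncard := by
        refine Set.ncard_le_ncard ?_ (Finset.finite_toSet _)
        rintro W ⟨ℓ₁, ℓ₂, h₁, h₂, -, rfl, -, hm₁, hm₂⟩
        obtain ⟨p, hpL, hp⟩ := exists_mem_span_pair_of_prod_mem h₁ h₂ hL₁ (hunsmul hc₁ hm₁)
        obtain ⟨q, hqL, hq⟩ := exists_mem_span_pair_of_prod_mem h₁ h₂ hL₂ (hunsmul hc₂ hm₂)
        have hqp : ¬ q ∣ p := fun hqp =>
          hgcd q (hL₂ q hqL) (hqp.trans (hdvd c₁ L₁ p hpL)) (hdvd c₂ L₂ q hqL)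
        rw [setOf_eval_eq_zero_of_mem_span_pair (hL₂ q hqL).1 hqp hp hq]
        exact Finset.mem_coe.2 (Finset.mem_image.2 ⟨(p, q), by simp [hpL, hqL], rfl⟩)
    _ ≤ (L₁.toFinset ×ˢ L₂.toFinset).card := by
        rw [Set.ncard_coe_finset]
        exact Finset.card_image_le
    _ ≤ d * d := by
        rw [Finset.card_product]
        exact Nat.mul_le_mul
          ((Multiset.toFinset_card_le L₁).trans (hcard₁.le.trans hmd))
          ((Multiset.toFinset_card_le L₂).trans (hcard₂.le.trans hmd))
    _ = d ^ 2 := (sq d).symm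
end

section
/- Let T_1, T_2 ∈ F[x_1,…,x_n] be products of linear forms, homogeneous of equal degree t ≥ 1, with no common linear factor (gcd(T_1,T_2) = 1). Suppose T_1 = α·y^t for some nonzero scalar α ∈ F and linear form y, and suppose the linear factors of T_2 span an F-subspace of dimension at least 3. Then T_1 + T_2 has no linear factors; consequently, for any product of linear forms G, Lin(G·(T_1+T_2)) equals G up to a scalar factor and NonLin(G·(T_1+T_2)) equals T_1 + T_2 up to a scalar factor. -/
open MvPolynomial

/-- The polynomial `∑ i, f (eᵢ) • X i` attached to a linear functional `f`. -/
noncomputable def polynomialOfDual (F : Type*) [Field F] (n : ℕ) :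
    Module.Dual F (Fin n → F) →ₗ[F] MvPolynomial (Fin n) F :=
  ∑ i, (LinearMap.toSpanSingleton F (MvPolynomial (Fin n) F) (X i)).comp
    (LinearMap.applyₗ (Pi.single i 1))

theorem polynomialOfDual_apply {F : Type*} [Field F] {n : ℕ} (f : Module.Dual F (Fin n → F)) :
    polynomialOfDual F n f = ∑ i, f (Pi.single i 1) • X i := by
  simp [polynomialOfDual]

theorem eval_polynomialOfDual {F : Type*} [Field F] {n : ℕ} (f : Module.Dual F (Fin n → F))
    (a : Fin n → F) : eval a (polynomialOfDual F n f) = f a := by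
  conv_rhs => rw [pi_eq_sum_univ' a]
  simp [polynomialOfDual_apply, smul_eval, mul_comm]

theorem MvPolynomial.IsHomogeneous.exists_polynomialOfDual_eq {F : Type*} [Field F] {n : ℕ}
    {p : MvPolynomial (Fin n) F} (hp : p.IsHomogeneous 1) :
    ∃ f, polynomialOfDual F n f = p := by
  have hmem : p ∈ Submodule.span F (Set.range (X : Fin n → MvPolynomial (Fin n) F)) := by
    rw [← homogeneousSubmodule_one_eq_span_X]
    exact hp
  obtain ⟨c, rfl⟩ := (Submodule.mem_span_range_iff_exists_fun F).1 hmem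
  refine ⟨Fintype.linearCombination F c, ?_⟩
  simp [polynomialOfDual_apply]

/-- A homogeneous polynomial of degree one vanishing on the common zeros of finitely many
such polynomials lies in their span. -/
theorem mem_span_range_of_forall_eval_eq_zero {F : Type*} [Field F] {n : ℕ} {ι : Type*} [Finite ι]
    {p : MvPolynomial (Fin n) F} {q : ι → MvPolynomial (Fin n) F} (hp : p.IsHomogeneous 1)
    (hq : ∀ i, (q i).IsHomogeneous 1)
    (h : ∀ a, (∀ i, eval a (q i) = 0) → eval a p = 0) :
    p ∈ Submodule.span F (Set.range q) := by
  obtain ⟨f, rfl⟩ := hp.exists_polynomialOfDual_eq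
  choose g hg using fun i => (hq i).exists_polynomialOfDual_eq
  obtain rfl : (fun i => polynomialOfDual F n (g i)) = q := funext hg
  have hf : f ∈ Submodule.span F (Set.range g) := by
    refine mem_span_of_iInf_ker_le_ker fun a ha => ?_
    simp only [eval_polynomialOfDual, Submodule.mem_iInf, LinearMap.mem_ker] at h ha ⊢
    exact h a ha
  have := Submodule.mem_map_of_mem (f := polynomialOfDual F n) hf
  rwa [Submodule.map_span, ← Set.range_comp] at this

theorem IsLinearForm.irreducible {F : Type*} [Field F] {n : ℕ} {p : MvPolynomial (Fin n) F}
    (hp : IsLinearForm p) : Irreducible p := by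
  refine irreducible_of_totalDegree_eq_one (hp.2.totalDegree hp.1) fun x hx => ?_
  rw [isUnit_iff_ne_zero]
  rintro rfl
  exact hp.1 (MvPolynomial.ext _ _ fun i => by simpa using hx i)

theorem IsProdLinearForms.ne_zero {F : Type*} [Field F] {n : ℕ} {g : MvPolynomial (Fin n) F}
    (hg : IsProdLinearForms g) : g ≠ 0 := by
  obtain ⟨c, L, hc, hL, rfl⟩ := hg
  exact smul_ne_zero hc (Multiset.prod_ne_zero fun h => (hL 0 h).1 rfl)

theorem IsProdLinearForms.isRelPrime {F : Type*} [Field F] {n : ℕ}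
    {g h : MvPolynomial (Fin n) F} (hg : IsProdLinearForms g) (hh : NoLinearFactor h) :
    IsRelPrime g h := by
  obtain ⟨c, L, hc, hL, rfl⟩ := hg
  have hprod : IsRelPrime L.prod h := by
    induction L using Multiset.induction_on with
    | empty => simpa using isRelPrime_one_left
    | cons p L ih =>
      rw [Multiset.prod_cons]
      have hp := hL p (Multiset.mem_cons_self p L)
      exact (hp.irreducible.isRelPrime_iff_not_dvd.2 (hh p hp)).mul_left
        (ih fun q hq => hL q (Multiset.mem_cons_of_mem hq))
  rw [smul_eq_C_mul]
  exact ((isUnit_iff_ne_zero.2 hc).map C).isRelPrime_left.mul_left hprod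

/-- The factorization into a product of linear forms and a polynomial without linear factors
is unique up to a scalar. -/
theorem IsProdLinearForms.exists_smul_eq_of_mul_eq_mul {F : Type*} [Field F] {n : ℕ}
    {g g' h h' : MvPolynomial (Fin n) F} (hg : IsProdLinearForms g) (hg' : IsProdLinearForms g')
    (hh : NoLinearFactor h) (hh' : NoLinearFactor h') (heq : g * h = g' * h') :
    ∃ c : F, c ≠ 0 ∧ g' = c • g ∧ c • h' = h := by
  have hdvd : g ∣ g' := (hg.isRelPrime hh').dvd_of_dvd_mul_right (Dvd.intro _ heq)
  have hdvd' : g' ∣ g := (hg'.isRelPrime hh).dvd_of_dvd_mul_right (Dvd.intro _ heq.symm)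
  obtain ⟨u, rfl⟩ := associated_of_dvd_dvd hdvd hdvd'
  obtain ⟨c, hc, hcu⟩ := isUnit_iff_eq_C_of_isReduced.1 u.isUnit
  rw [hcu] at heq ⊢
  refine ⟨c, hc.ne_zero, by rw [smul_eq_C_mul, mul_comm], ?_⟩
  rw [mul_assoc] at heq
  rw [smul_eq_C_mul, mul_left_cancel₀ hg.ne_zero heq]

/-- If linear forms `ℓ` and `m` divide `α • y ^ t + T` and `T` respectively, and `ℓ` does not
divide `y`, then `m` lies in the span of `ℓ` and `y`. -/
theorem IsLinearForm.mem_span_pair_of_dvd {F : Type*} [Field F] {n t : ℕ}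
    {ℓ m y T : MvPolynomial (Fin n) F} {α : F} (hℓ : IsLinearForm ℓ) (hm : IsLinearForm m)
    (hy : IsLinearForm y) (hα : α ≠ 0) (hℓy : ¬ ℓ ∣ y) (hℓT : ℓ ∣ α • y ^ t + T) (hmT : m ∣ T) :
    m ∈ Submodule.span F {ℓ, y} := by
  have hmem : y ∈ Submodule.span F (Set.range ![ℓ, m]) := by
    refine mem_span_range_of_forall_eval_eq_zero hy.2 ?_ fun a ha => ?_
    · simpa [Fin.forall_fin_two] using ⟨hℓ.2, hm.2⟩
    · obtain ⟨hℓ0, hm0⟩ : eval a ℓ = 0 ∧ eval a m = 0 := ⟨ha 0, ha 1⟩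
      have hsum : eval a (α • y ^ t + T) = 0 :=
        zero_dvd_iff.1 (hℓ0 ▸ map_dvd (eval a) hℓT)
      have hT : eval a T = 0 := zero_dvd_iff.1 (hm0 ▸ map_dvd (eval a) hmT)
      have : α * eval a y ^ t = 0 := by simpa [smul_eval, hT] using hsum
      exact eq_zero_of_pow_eq_zero ((mul_eq_zero.1 this).resolve_left hα)
  rw [Matrix.range_cons, Matrix.range_cons, Matrix.range_empty, Set.union_empty,
    Set.singleton_union, Submodule.mem_span_pair] at hmem
  obtain ⟨a, b, hab⟩ := hmem
  have hb : b ≠ 0 := by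
    rintro rfl
    exact hℓy ⟨C a, by rw [← hab, zero_smul, add_zero, smul_eq_C_mul, mul_comm]⟩
  refine Submodule.mem_span_pair.2 ⟨-(b⁻¹ * a), b⁻¹, ?_⟩
  rw [← hab, smul_add, smul_smul, smul_smul, inv_mul_cancel₀ hb, one_smul, neg_smul,
    neg_add_cancel_left]

/-- Corner case: if `T₁ = α·y^t` is a power of a linear form and the linear factors of
`T₂` span a space of dimension at least 3, then `T₁ + T₂` has no linear factors; hence
for any product of linear forms `G`, any factorization `G·(T₁+T₂) = Lf·Nf` with `Lf` a
product of linear forms and `Nf` without linear factors has `Lf = c·G` and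
`c·Nf = T₁+T₂` for some nonzero scalar `c`. -/
theorem corner_case_lin_nonlin_parts
    {F : Type*} [Field F] [Fintype F] {n t : ℕ}
    (T₁ T₂ : MvPolynomial (Fin n) F)
    (ht : 1 ≤ t)
    (hT₁ : IsProdLinearForms T₁) (hT₂ : IsProdLinearForms T₂)
    (hT₁hom : T₁.IsHomogeneous t) (hT₂hom : T₂.IsHomogeneous t)
    (hgcd : ∀ ℓ : MvPolynomial (Fin n) F, IsLinearForm ℓ → ℓ ∣ T₁ → ¬ ℓ ∣ T₂)
    (α : F) (hα : α ≠ 0) (y : MvPolynomial (Fin n) F) (hy : IsLinearForm y)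
    (hT₁eq : T₁ = α • y ^ t)
    (hspan : 3 ≤ Module.finrank F
      ↥(Submodule.span F {ℓ : MvPolynomial (Fin n) F | IsLinearForm ℓ ∧ ℓ ∣ T₂})) :
    NoLinearFactor (T₁ + T₂) ∧
    ∀ G Lf Nf : MvPolynomial (Fin n) F,
      IsProdLinearForms G → IsProdLinearForms Lf → NoLinearFactor Nf →
      G * (T₁ + T₂) = Lf * Nf →
      ∃ c : F, c ≠ 0 ∧ Lf = c • G ∧ c • Nf = T₁ + T₂ := by
  have hno : NoLinearFactor (T₁ + T₂) := by
    intro ℓ hℓ hdvd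
    subst hT₁eq
    have hℓy : ¬ ℓ ∣ y := fun h => by
      have hℓT₁ : ℓ ∣ α • y ^ t := by
        rw [smul_eq_C_mul]
        exact (dvd_pow h (by lia)).mul_left (C α)
      exact hgcd ℓ hℓ hℓT₁ ((dvd_add_right hℓT₁).1 hdvd)
    classical
    have hle : Submodule.span F {m | IsLinearForm m ∧ m ∣ T₂} ≤
        Submodule.span F (({ℓ, y} : Finset (MvPolynomial (Fin n) F)) : Set _) := by
      rw [Submodule.span_le, Finset.coe_pair]
      exact fun m hm => hℓ.mem_span_pair_of_dvd hm.1 hy hα hℓy hdvd hm.2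
    have hrank := (Submodule.finrank_mono hle).trans
      ((finrank_span_finset_le_card _).trans Finset.card_le_two)
    lia
  exact ⟨hno, fun G Lf Nf hG hLf hNf h => hG.exists_smul_eq_of_mul_eq_mul hLf hno hNf h⟩
end
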